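/- (Sanderson's dimension formula, second case.) The total mass of μ_{N,1} satisfies μ_{0,1}(Γ) = 1 and μ_{N,1}(Γ) = (n+1)·(m+n+1)^{N−1} for all N ≥ 1. -/

import Mathlib

open Finsupp Filter

noncomputable section

/-- Signed-sum convention: `signedSum c k = Σ_{i=0}^{k} c i`, which is the ordinary sum for
`k ≥ 0`, is `0` for `k = -1`, and equals `-(c (-1) + c (-2) + ⋯ + c (k+1))` for `k ≤ -2`. -/
def signedSum {M : Type*} [AddCommGroup M] (c : ℤ → M) (k : ℤ) : M :=
  (∑ i ∈ Finset.range (k + 1).toNat, c i) -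
    ∑ i ∈ Finset.range (-(k + 1)).toNat, c (-((i : ℤ) + 1))

/-- The Demazure operator `D₀` (relative to `Λ = mΛ₀ + nΛ₁`):
`D₀ δ_{(a,b)} = Σ_{i=0}^{m - 2(a-b)} δ_{(a+i,b)}`, extended ℤ-linearly. -/
def D0 (m : ℕ) (μ : ℤ × ℤ →₀ ℤ) : ℤ × ℤ →₀ ℤ :=
  μ.sum fun p c =>
    c • signedSum (fun i => Finsupp.single (p.1 + i, p.2) (1 : ℤ)) ((m : ℤ) - 2 * (p.1 - p.2))

/-- The Demazure operator `D₁` (relative to `Λ = mΛ₀ + nΛ₁`):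
`D₁ δ_{(a,b)} = Σ_{i=0}^{n + 2(a-b)} δ_{(a,b+i)}`, extended ℤ-linearly. -/
def D1 (n : ℕ) (μ : ℤ × ℤ →₀ ℤ) : ℤ × ℤ →₀ ℤ :=
  μ.sum fun p c =>
    c • signedSum (fun i => Finsupp.single (p.1, p.2 + i) (1 : ℤ)) ((n : ℤ) + 2 * (p.1 - p.2))

/-- Total mass `μ(Γ)` of a finitely supported function on `ℤ × ℤ`. -/
def mass (μ : ℤ × ℤ →₀ ℤ) : ℤ := μ.sum fun _ c => c

/-- Expected value `E_ν[f] = (1/ν(Γ)) Σ ν(a,b) f(a,b)`. -/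
def expVal (ν : ℤ × ℤ →₀ ℤ) (f : ℤ × ℤ → ℚ) : ℚ :=
  (mass ν : ℚ)⁻¹ * ν.sum fun p c => (c : ℚ) * f p

/-- Covariance `Cov_ν(f,g) = E_ν[f·g] - E_ν[f]·E_ν[g]`. -/
def cov (ν : ℤ × ℤ →₀ ℤ) (f g : ℤ × ℤ → ℚ) : ℚ :=
  expVal ν (fun p => f p * g p) - expVal ν f * expVal ν g

/-- Variance `Var_ν(f) = Cov_ν(f,f)`. -/
def var (ν : ℤ × ℤ →₀ ℤ) (f : ℤ × ℤ → ℚ) : ℚ := cov ν f f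

/-- The coordinate function `a` (the degree). -/
def fa : ℤ × ℤ → ℚ := fun p => (p.1 : ℚ)

/-- The coordinate function `b`. -/
def fb : ℤ × ℤ → ℚ := fun p => (p.2 : ℚ)

/-- The finite-weight coordinate `a - b`. -/
def fab : ℤ × ℤ → ℚ := fun p => (p.1 : ℚ) - (p.2 : ℚ)

/-- `μ_{N,0}`: start from `δ_{(0,0)}`, apply `D₀` at odd steps and `D₁` at even steps. -/
def mu0 (m n : ℕ) : ℕ → (ℤ × ℤ →₀ ℤ)
  | 0 => Finsupp.single (0, 0) 1
  | N + 1 => if N % 2 = 0 then D0 m (mu0 m n N) else D1 n (mu0 m n N)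

/-- `μ_{N,1}`: start from `δ_{(0,0)}`, apply `D₁` at odd steps and `D₀` at even steps. -/
def mu1 (m n : ℕ) : ℕ → (ℤ × ℤ →₀ ℤ)
  | 0 => Finsupp.single (0, 0) 1
  | N + 1 => if N % 2 = 0 then D1 n (mu1 m n N) else D0 m (mu1 m n N)

theorem signedSum_sub {M : Type*} [AddCommGroup M] (F : ℤ → M) (k : ℤ) :
    signedSum (fun i => F (i + 1) - F i) k = F (k + 1) - F 0 := by
  have h₁ (t : ℕ) : ∑ i ∈ Finset.range t, (F ((i : ℤ) + 1) - F i) = F t - F 0 := by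
    simpa using Finset.sum_range_sub (fun i : ℕ => F i) t
  have h₂ (t : ℕ) : ∑ i ∈ Finset.range t, (F (-((i : ℤ) + 1) + 1) - F (-((i : ℤ) + 1))) =
      F 0 - F (-t) := by
    simpa using Finset.sum_range_sub' (fun i : ℕ => F (-(i : ℤ))) t
  unfold signedSum
  rw [h₁, h₂]
  rcases le_total 0 (k + 1) with h | h
  · rw [Int.toNat_of_nonneg h, Int.toNat_of_nonpos (by lia)]
    simp
  · rw [Int.toNat_of_nonpos h, Int.toNat_of_nonneg (by lia)]
    simp

theorem map_signedSum {M N : Type*} [AddCommGroup M] [AddCommGroup N] (φ : M →ₗ[ℤ] N)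
    (c : ℤ → M) (k : ℤ) : φ (signedSum c k) = signedSum (fun i => φ (c i)) k := by
  simp [signedSum]

/-- Integration of `f` against a finitely supported function on `ℤ × ℤ`. -/
def moment (f : ℤ × ℤ → ℤ) : (ℤ × ℤ →₀ ℤ) →ₗ[ℤ] ℤ := Finsupp.linearCombination ℤ f

theorem moment_single (f : ℤ × ℤ → ℤ) (p : ℤ × ℤ) (c : ℤ) :
    moment f (Finsupp.single p c) = c * f p := by
  simp [moment]

theorem mass_eq_moment (μ : ℤ × ℤ →₀ ℤ) : mass μ = moment (fun _ => 1) μ := by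
  simp [mass, moment, Finsupp.linearCombination_apply]

theorem mass_single (p : ℤ × ℤ) (c : ℤ) : mass (Finsupp.single p c) = c := by
  simp [mass_eq_moment, moment_single]

theorem moment_D0 (m : ℕ) (f g : ℤ × ℤ → ℤ) (μ : ℤ × ℤ →₀ ℤ)
    (h : ∀ p : ℤ × ℤ,
      signedSum (fun i => f (p.1 + i, p.2)) ((m : ℤ) - 2 * (p.1 - p.2)) = g p) :
    moment f (D0 m μ) = moment g μ := by
  simp only [D0, map_finsuppSum, map_smul, map_signedSum, moment_single, one_mul, h]
  simp [moment, Finsupp.linearCombination_apply]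

theorem moment_D1 (n : ℕ) (f g : ℤ × ℤ → ℤ) (μ : ℤ × ℤ →₀ ℤ)
    (h : ∀ p : ℤ × ℤ,
      signedSum (fun i => f (p.1, p.2 + i)) ((n : ℤ) + 2 * (p.1 - p.2)) = g p) :
    moment f (D1 n μ) = moment g μ := by
  simp only [D1, map_finsuppSum, map_smul, map_signedSum, moment_single, one_mul, h]
  simp [moment, Finsupp.linearCombination_apply]

theorem signedSum_one (k : ℤ) : signedSum (fun _ => (1 : ℤ)) k = k + 1 := by
  simpa using signedSum_sub (fun i : ℤ => i) k

theorem signedSum_affine (x r k : ℤ) :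
    signedSum (fun i => x + 2 * r * i) k = (k + 1) * (x + r * k) := by
  have h := signedSum_sub (fun i : ℤ => x * i + r * (i * (i - 1))) k
  convert h using 1
  · congr 1
    funext i
    ring
  · ring

theorem moment_affine (u v : ℤ) (μ : ℤ × ℤ →₀ ℤ) :
    moment (fun p => u + v * (2 * (p.1 - p.2))) μ =
      u * mass μ + v * moment (fun p => 2 * (p.1 - p.2)) μ := by
  simp only [mass_eq_moment, moment, Finsupp.linearCombination_apply, Finsupp.sum,
    Finset.mul_sum, ← Finset.sum_add_distrib, smul_eq_mul]
  exact Finset.sum_congr rfl fun _ _ => by ring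

theorem mass_D0 (m : ℕ) (μ : ℤ × ℤ →₀ ℤ) :
    mass (D0 m μ) = (m + 1) * mass μ - moment (fun p => 2 * (p.1 - p.2)) μ := by
  rw [mass_eq_moment, moment_D0 m _ (fun p => (m + 1) + (-1) * (2 * (p.1 - p.2))) μ,
    moment_affine]
  · ring
  · intro p
    rw [signedSum_one]
    ring

theorem mass_D1 (n : ℕ) (μ : ℤ × ℤ →₀ ℤ) :
    mass (D1 n μ) = (n + 1) * mass μ + moment (fun p => 2 * (p.1 - p.2)) μ := by
  rw [mass_eq_moment, moment_D1 n _ (fun p => (n + 1) + 1 * (2 * (p.1 - p.2))) μ,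
    moment_affine]
  · ring
  · intro p
    rw [signedSum_one]
    ring

theorem moment_sub_D0 (m : ℕ) (μ : ℤ × ℤ →₀ ℤ) :
    moment (fun p => 2 * (p.1 - p.2)) (D0 m μ) = m * mass (D0 m μ) := by
  rw [mass_D0, moment_D0 m _ (fun p => m * (m + 1) + (-m) * (2 * (p.1 - p.2))) μ,
    moment_affine]
  · ring
  · intro p
    have h := signedSum_affine (2 * (p.1 - p.2)) 1 (m - 2 * (p.1 - p.2))
    convert h using 1
    · congr 1
      funext i
      ring
    · ring

theorem moment_sub_D1 (n : ℕ) (μ : ℤ × ℤ →₀ ℤ) :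
    moment (fun p => 2 * (p.1 - p.2)) (D1 n μ) = -n * mass (D1 n μ) := by
  rw [mass_D1, moment_D1 n _ (fun p => -n * (n + 1) + (-n) * (2 * (p.1 - p.2))) μ,
    moment_affine]
  · ring
  · intro p
    have h := signedSum_affine (2 * (p.1 - p.2)) (-1) (n + 2 * (p.1 - p.2))
    convert h using 1
    · congr 1
      funext i
      ring
    · ring

/-- After the first step, each further step multiplies the mass by `m + n + 1`. -/
theorem mass_mu1_add_two (m n N : ℕ) :
    mass (mu1 m n (N + 2)) = ((m : ℤ) + n + 1) * mass (mu1 m n (N + 1)) := by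
  rcases Nat.mod_two_eq_zero_or_one N with h | h
  · have h' : (N + 1) % 2 ≠ 0 := by lia
    rw [mu1, if_neg h', mass_D0, mu1, if_pos h, moment_sub_D1]
    ring
  · have h' : (N + 1) % 2 = 0 := by lia
    rw [mu1, if_pos h', mass_D1, mu1, if_neg (by lia), moment_sub_D0]
    ring

/-- Sanderson's dimension formula, second case:
`μ_{0,1}(Γ) = 1` and `μ_{N,1}(Γ) = (n+1)(m+n+1)^{N-1}` for `N ≥ 1`. -/
theorem stmt_6 (m n : ℕ) :
    mass (mu1 m n 0) = 1 ∧
    ∀ N : ℕ, 1 ≤ N →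
      mass (mu1 m n N) = ((n : ℤ) + 1) * ((m : ℤ) + (n : ℤ) + 1) ^ (N - 1) := by
  refine ⟨by simp [mu1, mass_single], fun N hN => ?_⟩
  obtain ⟨N, rfl⟩ := Nat.exists_eq_add_of_le' hN
  rw [Nat.add_sub_cancel]
  induction N with
  | zero => simp [mu1, mass_D1, moment_single, mass_single]
  | succ N ih =>
    rw [mass_mu1_add_two, ih (by lia)]
    ring
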